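/- Let r ≥ 1, λ_1,…,λ_r > 0 with Σ_{j=1}^r λ_j = 1, μ_1,…,μ_r ∈ ℂ, θ = Im(2Σ_{j=1}^r(μ_j - 1/2)). Define, as above, R_ν(s) = B_{ν+1}(1-2s-iθ) + B_{ν+1}(1) - Σ_{j=1}^r (B_{ν+1}(λ_j(1-s)+conj(μ_j)) + B_{ν+1}(1-λ_j s-μ_j))/λ_j^ν; V_ν(s) = (-1)^ν Σ_{m=1}^{ν} (1/m!) Σ_{ν_1+⋯+ν_m=ν, ν_i≥1} ∏_{i=1}^m R_{ν_i}(s)/(ν_i(ν_i+1)); C_{μ,ℓ} by C_{1,ℓ} = (-1)^{ℓ-1}(ℓ-1)! and C_{μ+1,ℓ} = (-1)^{ℓ-1}(ℓ-1)! Σ_{m=μ}^{ℓ-1}(-1)^m C_{μ,m}/m!; A_{μ,ν}(s) = Σ_{k=0}^{ν-μ} binom(-μ,k) C_{μ+k,ν}(2s-1+iθ)^k; and Q_ν(s) = Σ_{μ=1}^{ν} V_μ(s) A_{μ,ν}(s). Then: (a) for every real c ≥ 1 there is a constant A > 0 such that for every integer K > 0, all s with |s| ≤ 2K and all integers ν with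 1 ≤ ν ≤ K + c, one has |R_ν(s)| ≤ A^K K^ν, |V_ν(s)| ≤ A^K K^ν and |Q_ν(s)| ≤ (AK)^K; and (b) for every ν ≥ 1, Q_ν(s) is a polynomial in s of degree exactly 2ν. -/

import Mathlib

theorem aux_bern (n : ℕ) : |(bernoulli n : ℚ)| ≤ (n.factorial : ℚ) := by
  induction n using Nat.strong_induction_on with
  | _ n ih =>
  rcases Nat.eq_zero_or_pos n with rfl | hn
  · simp
  have h := sum_bernoulli (n + 1)
  rw [if_neg (by omega), Finset.sum_range_succ] at h
  have h1 : ((n + 1 : ℕ) : ℚ) * bernoulli n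
      = - ∑ k ∈ Finset.range n, ((n + 1).choose k : ℚ) * bernoulli k := by
    have : ((n+1).choose n : ℚ) = ((n+1 : ℕ) : ℚ) := by
      rw [Nat.choose_succ_self_right]
    rw [this] at h
    linarith
  have h2 : ((n + 1 : ℕ) : ℚ) * |bernoulli n| ≤ ((n+1 : ℕ) : ℚ) * n.factorial := by
    have e : ((n + 1 : ℕ) : ℚ) * |bernoulli n| = |((n + 1 : ℕ) : ℚ) * bernoulli n| := by
      rw [abs_mul, abs_of_nonneg (by positivity : (0:ℚ) ≤ ((n + 1 : ℕ) : ℚ))]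
    rw [e, h1, abs_neg]
    refine (Finset.abs_sum_le_sum_abs _ _).trans ?_
    have h3 : ∀ k ∈ Finset.range n, |((n + 1).choose k : ℚ) * bernoulli k| ≤
        ((n+1).factorial : ℚ) * (1/2)^(n-k) := by
      intro k hk
      have hk' := Finset.mem_range.mp hk
      rw [abs_mul, abs_of_nonneg (by positivity : (0:ℚ) ≤ ((n + 1).choose k : ℚ))]
      have h4 := ih k hk'
      have h5 : (((n+1).choose k : ℚ)) * k.factorial * (n+1-k).factorial = (n+1).factorial := by
        exact_mod_cast Nat.choose_mul_factorial_mul_factorial (by omega : k ≤ n+1)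
      have h6 : (2:ℚ)^(n-k) ≤ (n+1-k).factorial := by
        have := Nat.two_pow_mul_factorial_le_factorial_two_mul 0
        have h7 : ∀ j : ℕ, 2^j ≤ (j+1).factorial := by
          intro j
          induction j with
          | zero => simp
          | succ j ij =>
            rw [pow_succ, Nat.factorial_succ (j+1)]
            nlinarith
        have := h7 (n-k)
        rw [show n - k + 1 = n + 1 - k by omega] at this
        exact_mod_cast this
      calc _ ≤ ((n+1).choose k : ℚ) * k.factorial := by gcongr
        _ ≤ _ := by
          rw [← h5, one_div, inv_pow, ← div_eq_mul_inv, le_div_iff₀ (by positivity)]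
          gcongr
    refine (Finset.sum_le_sum h3).trans ?_
    rw [← Finset.mul_sum, Nat.factorial_succ]
    have h8 : ∑ k ∈ Finset.range n, (1/2:ℚ)^(n-k) ≤ 1 := by
      have : ∀ n : ℕ, ∑ k ∈ Finset.range n, (1/2:ℚ)^(n-k) = 1 - (1/2)^n := by
        intro n
        induction n with
        | zero => simp
        | succ n i =>
          rw [Finset.sum_range_succ]
          have : ∑ k ∈ Finset.range n, (1/2:ℚ)^(n+1-k) = ∑ k ∈ Finset.range n, (1/2:ℚ)^(n-k) * (1/2) := by
            refine Finset.sum_congr rfl fun k hk => ?_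
            have := Finset.mem_range.mp hk
            rw [show n + 1 - k = (n-k) + 1 by omega, pow_succ]
          rw [this, ← Finset.sum_mul, i]
          simp
          ring
      rw [this]
      have : (0:ℚ) ≤ (1/2)^n := by positivity
      linarith
    push_cast
    exact mul_le_of_le_one_right (by positivity) h8
  exact le_of_mul_le_mul_left h2 (by positivity)

theorem aux_bpoly (n : ℕ) (x : ℂ) (X : ℝ) (hx : ‖x‖ ≤ X) (hn : (n : ℝ) ≤ X) :
    ‖Polynomial.aeval x (Polynomial.bernoulli n)‖ ≤ (2 * X) ^ n := by
  have hX : 0 ≤ X := (norm_nonneg _).trans hx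
  rw [Polynomial.bernoulli, map_sum]
  refine (norm_sum_le _ _).trans ?_
  have : ∀ i ∈ Finset.range (n+1), ‖Polynomial.aeval x (Polynomial.monomial (n - i) (bernoulli i * (n.choose i : ℚ)))‖ ≤ X ^ n := by
    intro i hi
    have hi' : i ≤ n := by have := Finset.mem_range.mp hi; omega
    rw [Polynomial.aeval_monomial, norm_mul, norm_pow]
    have h1 : ‖(algebraMap ℚ ℂ) (bernoulli i * (n.choose i : ℚ))‖ ≤ X ^ i := by
      have e : (algebraMap ℚ ℂ) (bernoulli i * (n.choose i : ℚ)) = (((bernoulli i * (n.choose i : ℚ) : ℚ) : ℝ) : ℂ) := by simp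
      rw [e, Complex.norm_real, Real.norm_eq_abs, ← Rat.cast_abs, abs_mul]
      have h2 : |bernoulli i| * |(n.choose i : ℚ)| ≤ (n:ℚ)^i := by
        rw [abs_of_nonneg (by positivity : (0:ℚ) ≤ (n.choose i : ℚ))]
        calc _ ≤ (i.factorial : ℚ) * n.choose i := by gcongr; exact aux_bern i
          _ = (n.descFactorial i : ℚ) := by rw [Nat.descFactorial_eq_factorial_mul_choose]; push_cast; rfl
          _ ≤ _ := by exact_mod_cast Nat.descFactorial_le_pow n i
      calc (((|bernoulli i| * |(n.choose i : ℚ)| : ℚ)) : ℝ) ≤ (((n:ℚ)^i : ℚ) : ℝ) := by exact_mod_cast h2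
        _ = (n:ℝ)^i := by push_cast; rfl
        _ ≤ _ := by gcongr
    calc _ ≤ X ^ i * X ^ (n - i) := by gcongr
      _ = X ^ n := by rw [← pow_add]; congr 1; omega
  refine (Finset.sum_le_sum this).trans ?_
  rw [Finset.sum_const, Finset.card_range, nsmul_eq_mul, mul_pow]
  gcongr
  exact_mod_cast Nat.lt_two_pow_self

theorem aux_R
    (r : ℕ) (lam : Fin r → ℝ) (hlam : ∀ j, 0 < lam j)
    (hsum : ∑ j, lam j = 1)
    (mu : Fin r → ℂ) (θ : ℝ) 
    (R : ℕ → ℂ → ℂ)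
    (hR : ∀ (ν : ℕ) (s : ℂ), R ν s =
      Polynomial.aeval (1 - 2 * s - (θ : ℂ) * Complex.I) (Polynomial.bernoulli (ν + 1)) +
        Polynomial.aeval (1 : ℂ) (Polynomial.bernoulli (ν + 1)) -
        ∑ j, (Polynomial.aeval ((lam j : ℂ) * (1 - s) + (starRingEnd ℂ) (mu j))
              (Polynomial.bernoulli (ν + 1)) +
            Polynomial.aeval (1 - (lam j : ℂ) * s - mu j) (Polynomial.bernoulli (ν + 1))) /
          (lam j : ℂ) ^ ν) (n : ℕ) :
    ∃ B : ℝ, 1 ≤ B ∧ ∀ K : ℕ, 0 < K → ∀ s : ℂ, ‖s‖ ≤ 2 * K →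
        ∀ ν : ℕ, 1 ≤ ν → ν ≤ K + n → ‖R ν s‖ ≤ B ^ ν * (K:ℝ) ^ (ν + 1) := by
  obtain ⟨T, hT⟩ : ∃ T, T = ∑ j, ‖mu j‖ := ⟨_, rfl⟩
  obtain ⟨Λ, hΛ⟩ : ∃ Λ, Λ = 1 + ∑ j, 1 / lam j := ⟨_, rfl⟩
  have hT0 : 0 ≤ T := by rw [hT]; positivity
  have hTj : ∀ j, ‖mu j‖ ≤ T := fun j => by
    rw [hT]; exact Finset.single_le_sum (f := fun j => ‖mu j‖) (fun _ _ => norm_nonneg _) (Finset.mem_univ j)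
  have hl1 : ∀ j, lam j ≤ 1 := fun j => by
    rw [← hsum]; exact Finset.single_le_sum (f := lam) (fun i _ => (hlam i).le) (Finset.mem_univ j)
  have hpos : ∀ j, 0 ≤ 1 / lam j := fun j => by have := hlam j; positivity
  have hΛ1 : 1 ≤ Λ := by
    rw [hΛ]; have := Finset.sum_nonneg (s := Finset.univ) (fun j _ => hpos j); linarith
  have hΛj : ∀ j, 1 / lam j ≤ Λ := fun j => by
    rw [hΛ]
    have := Finset.single_le_sum (f := fun j => 1 / lam j) (fun i _ => hpos i) (Finset.mem_univ j)
    linarith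
  obtain ⟨M, hM⟩ : ∃ M, M = 5 + |θ| + T + n := ⟨_, rfl⟩
  have hM1 : 1 ≤ M := by rw [hM]; have := abs_nonneg θ; have : (0:ℝ) ≤ n := by positivity
                         linarith
  refine ⟨(2 + 2 * r) * (2 * M)^2 * Λ, ?_, ?_⟩
  · have h1 : (1:ℝ) ≤ 2 + 2 * r := by have : (0:ℝ) ≤ r := by positivity
                                      linarith
    have h2 : (1:ℝ) ≤ (2*M)^2 := one_le_pow₀ (by linarith)
    exact one_le_mul_of_one_le_of_one_le (one_le_mul_of_one_le_of_one_le h1 h2) hΛ1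
  intro K hK s hs ν hν1 hν
  have hK1 : (1:ℝ) ≤ K := by exact_mod_cast hK
  have hX : 1 + 4 * (K:ℝ) + |θ| + T + n ≤ M * K := by
    rw [hM]; have := abs_nonneg θ; have : (0:ℝ) ≤ n := by positivity
    nlinarith
  have hθ0 := abs_nonneg θ
  have hn0 : (0:ℝ) ≤ n := by positivity
  have hν' : ((ν + 1 : ℕ) : ℝ) ≤ M * K := by
    have : (ν:ℝ) ≤ K + n := by exact_mod_cast hν
    push_cast; linarith
  have b0 : ‖(1 - 2 * s - (θ : ℂ) * Complex.I)‖ ≤ M * K := by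
    calc _ ≤ ‖(1:ℂ)‖ + ‖2 * s‖ + ‖(θ : ℂ) * Complex.I‖ := by
            refine (norm_sub_le _ _).trans ?_
            gcongr; exact norm_sub_le _ _
      _ = 1 + 2 * ‖s‖ + |θ| := by simp
      _ ≤ _ := by linarith
  have b1 : ‖(1:ℂ)‖ ≤ M * K := by simp; nlinarith
  have hls : ∀ j (z : ℂ), ‖(lam j : ℂ) * z‖ ≤ ‖z‖ := fun j z => by
    rw [norm_mul, Complex.norm_real, Real.norm_eq_abs, abs_of_pos (hlam j)]
    exact mul_le_of_le_one_left (norm_nonneg _) (hl1 j)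
  have b2 : ∀ j, ‖(lam j : ℂ) * (1 - s) + (starRingEnd ℂ) (mu j)‖ ≤ M * K := fun j => by
    have h1 := norm_add_le ((lam j : ℂ) * (1 - s)) ((starRingEnd ℂ) (mu j))
    have h2 := hls j (1-s)
    have h3 := norm_sub_le 1 s
    have h4 := hTj j
    rw [Complex.norm_conj] at h1
    rw [norm_one] at h3
    linarith
  have b3 : ∀ j, ‖1 - (lam j : ℂ) * s - mu j‖ ≤ M * K := fun j => by
    have h1 := norm_sub_le (1 - (lam j : ℂ) * s) (mu j)
    have h2 := hls j s
    have h3 := norm_sub_le 1 ((lam j : ℂ) * s)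
    have h4 := hTj j
    rw [norm_one] at h3
    linarith
  rw [hR]
  have key := fun x hx => aux_bpoly (ν+1) x (M*K) hx hν'
  set Y := (2 * (M * (K:ℝ)))^(ν+1) with hY
  have hY0 : 0 ≤ Y := by positivity
  have hΛν : 1 ≤ Λ ^ ν := one_le_pow₀ hΛ1
  have hj : ∀ j ∈ Finset.univ, ‖(Polynomial.aeval ((lam j : ℂ) * (1 - s) + (starRingEnd ℂ) (mu j))
              (Polynomial.bernoulli (ν + 1)) +
            Polynomial.aeval (1 - (lam j : ℂ) * s - mu j) (Polynomial.bernoulli (ν + 1))) /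
          (lam j : ℂ) ^ ν‖ ≤ 2 * Y * Λ ^ ν := by
    intro j _
    rw [norm_div, norm_pow, Complex.norm_real, Real.norm_eq_abs, abs_of_pos (hlam j), div_eq_mul_inv,
      ← inv_pow, ← one_div]
    have := hpos j
    have := hΛj j
    gcongr
    refine (norm_add_le _ _).trans ?_
    have := key _ (b2 j)
    have := key _ (b3 j)
    linarith
  have hS := (norm_sum_le _ _).trans (Finset.sum_le_sum hj)
  rw [Finset.sum_const, Finset.card_univ, Fintype.card_fin, nsmul_eq_mul] at hS
  refine (norm_sub_le _ _).trans ?_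
  have h0 := key _ b0
  have h1 := key _ b1
  have h01 := norm_add_le (Polynomial.aeval (1 - 2 * s - (θ : ℂ) * Complex.I) (Polynomial.bernoulli (ν + 1))) (Polynomial.aeval (1 : ℂ) (Polynomial.bernoulli (ν + 1)))
  have hr0 : (0:ℝ) ≤ r := by positivity
  calc _ ≤ (2 + 2 * r) * Y * Λ ^ ν := by nlinarith
    _ = (2 + 2 * r) * (2 * M) ^ (ν+1) * Λ ^ ν * (K:ℝ)^(ν+1) := by rw [hY]; ring
    _ ≤ (2 + 2 * r)^ν * (2 * M) ^ (2 * ν) * Λ ^ ν * (K:ℝ)^(ν+1) := by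
      gcongr
      · exact le_self_pow₀ (by linarith) (by omega)
      · linarith
      · omega
    _ = _ := by rw [pow_mul, ← mul_pow, ← mul_pow]

theorem aux_V (R : ℕ → ℂ → ℂ) (V : ℕ → ℂ → ℂ)
    (hV : ∀ (ν : ℕ) (s : ℂ), 1 ≤ ν → V ν s =
      (-1 : ℂ) ^ ν * ∑ m ∈ Finset.Icc 1 ν, (1 / (Nat.factorial m : ℂ)) *
        ∑ t ∈ (Finset.Nat.antidiagonalTuple m ν).filter (fun t => ∀ i, 1 ≤ t i),
          ∏ i, R (t i) s / (((t i : ℕ) : ℂ) * (((t i : ℕ) : ℂ) + 1)))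
    (B : ℝ) (hB : 1 ≤ B) (K : ℕ) (s : ℂ) (ν : ℕ) (hν : 1 ≤ ν)
    (hR : ∀ n, 1 ≤ n → n ≤ ν → ‖R n s‖ ≤ B ^ n * (K:ℝ) ^ (n + 1)) :
    ‖V ν s‖ ≤ Real.exp K * (2 * B * K) ^ ν := by
  rw [hV ν s hν, norm_mul, norm_pow, norm_neg, norm_one, one_pow, one_mul]
  have inner : ∀ m : ℕ, ‖∑ t ∈ (Finset.Nat.antidiagonalTuple m ν).filter (fun t => ∀ i, 1 ≤ t i),
          ∏ i, R (t i) s / (((t i : ℕ) : ℂ) * (((t i : ℕ) : ℂ) + 1))‖ ≤ (K:ℝ) ^ m * (2 * B * K) ^ ν := by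
    intro m
    refine (norm_sum_le _ _).trans ?_
    have hsub : (Finset.Nat.antidiagonalTuple m ν).filter (fun t => ∀ i, 1 ≤ t i) ⊆
        Fintype.piFinset (fun _ : Fin m => Finset.Icc 1 ν) := by
      intro t ht
      rw [Finset.mem_filter, Finset.Nat.mem_antidiagonalTuple] at ht
      rw [Fintype.mem_piFinset]
      intro i
      rw [Finset.mem_Icc]
      refine ⟨ht.2 i, ?_⟩
      rw [← ht.1]
      exact Finset.single_le_sum (f := t) (fun _ _ => Nat.zero_le _) (Finset.mem_univ i)
    have hterm : ∀ t ∈ (Finset.Nat.antidiagonalTuple m ν).filter (fun t => ∀ i, 1 ≤ t i),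
        ‖∏ i, R (t i) s / (((t i : ℕ) : ℂ) * (((t i : ℕ) : ℂ) + 1))‖ ≤
        (K:ℝ) ^ m * (2 * B * K) ^ ν * ∏ i, (1/2:ℝ)^(t i) := by
      intro t ht
      have ht' := Fintype.mem_piFinset.mp (hsub ht)
      rw [Finset.mem_filter, Finset.Nat.mem_antidiagonalTuple] at ht
      rw [norm_prod]
      have h1 : ∀ i ∈ Finset.univ, ‖R (t i) s / (((t i : ℕ) : ℂ) * (((t i : ℕ) : ℂ) + 1))‖ ≤
          (K:ℝ) * (2 * B * K)^(t i) * (1/2:ℝ)^(t i) := by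
        intro i _
        have h2 := Finset.mem_Icc.mp (ht' i)
        have h3 := hR (t i) h2.1 h2.2
        have h4 : (1:ℝ) ≤ ‖(((t i : ℕ) : ℂ) * (((t i : ℕ) : ℂ) + 1))‖ := by
          have : (((t i : ℕ) : ℂ) * (((t i : ℕ) : ℂ) + 1)) = ((t i * (t i + 1) : ℕ) : ℂ) := by push_cast; rfl
          rw [this, Complex.norm_natCast]
          have : 1 ≤ t i * (t i + 1) := by nlinarith [h2.1]
          exact_mod_cast this
        rw [norm_div]
        refine (div_le_self (norm_nonneg _) h4).trans (h3.trans (le_of_eq ?_))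
        rw [mul_assoc (K:ℝ), ← mul_pow, show 2 * B * K * (1/2) = B * K by ring, mul_pow]
        ring
      refine (Finset.prod_le_prod (fun _ _ => norm_nonneg _) h1).trans (le_of_eq ?_)
      rw [Finset.prod_mul_distrib, Finset.prod_mul_distrib, Finset.prod_pow_eq_pow_sum, ht.1]
      simp
    refine (Finset.sum_le_sum hterm).trans ?_
    rw [← Finset.mul_sum]
    refine mul_le_of_le_one_right (by positivity) ?_
    refine (Finset.sum_le_sum_of_subset_of_nonneg hsub (fun _ _ _ => by positivity)).trans ?_
    rw [← Finset.prod_univ_sum (fun _ : Fin m => Finset.Icc 1 ν) (fun _ k => (1/2:ℝ)^k)]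
    refine Finset.prod_le_one (fun _ _ => by positivity) (fun _ _ => ?_)
    have : ∀ n : ℕ, ∑ k ∈ Finset.Icc 1 n, (1/2:ℝ)^k = 1 - (1/2)^n := by
      intro n
      induction n with
      | zero => simp
      | succ n i =>
        rw [Finset.sum_Icc_succ_top (by omega), i]
        ring
    rw [this]
    have : (0:ℝ) ≤ (1/2)^ν := by positivity
    linarith
  refine (norm_sum_le _ _).trans ?_
  have h5 : ∀ m ∈ Finset.Icc 1 ν, ‖(1 / (Nat.factorial m : ℂ)) *
        ∑ t ∈ (Finset.Nat.antidiagonalTuple m ν).filter (fun t => ∀ i, 1 ≤ t i),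
          ∏ i, R (t i) s / (((t i : ℕ) : ℂ) * (((t i : ℕ) : ℂ) + 1))‖ ≤
      (K:ℝ)^m / m.factorial * (2 * B * K) ^ ν := by
    intro m _
    rw [norm_mul, norm_div, norm_one, Complex.norm_natCast]
    calc _ ≤ 1 / (m.factorial : ℝ) * ((K:ℝ) ^ m * (2 * B * K) ^ ν) := by
          gcongr; exact inner m
      _ = _ := by ring
  refine (Finset.sum_le_sum h5).trans ?_
  rw [← Finset.sum_mul]
  gcongr
  refine le_trans ?_ (Real.sum_le_exp_of_nonneg (Nat.cast_nonneg K) (ν+1))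
  refine Finset.sum_le_sum_of_subset_of_nonneg ?_ (fun _ _ _ => by positivity)
  intro m hm
  have := Finset.mem_Icc.mp hm
  exact Finset.mem_range.mpr (by omega)

theorem aux_Cdiag (C : ℕ → ℕ → ℂ)
    (hC1 : ∀ ℓ : ℕ, 1 ≤ ℓ → C 1 ℓ = (-1 : ℂ) ^ (ℓ - 1) * (Nat.factorial (ℓ - 1)))
    (hCrec : ∀ μ ℓ : ℕ, 1 ≤ μ → μ + 1 ≤ ℓ →
      C (μ + 1) ℓ = (-1 : ℂ) ^ (ℓ - 1) * (Nat.factorial (ℓ - 1)) *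
        ∑ m ∈ Finset.Icc μ (ℓ - 1), (-1 : ℂ) ^ m * C μ m / (Nat.factorial m))
    (μ : ℕ) (hμ : 1 ≤ μ) : C μ μ = 1 := by
  induction μ, hμ using Nat.le_induction with
  | base => rw [hC1 1 le_rfl]; simp
  | succ μ hμ ih =>
    rw [hCrec μ (μ+1) hμ le_rfl]
    simp only [Nat.add_sub_cancel, Finset.Icc_self, Finset.sum_singleton, ih]
    have : (μ.factorial : ℂ) ≠ 0 := by exact_mod_cast μ.factorial_ne_zero
    field_simp
    rw [← pow_mul, mul_comm, pow_mul]; simp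

theorem aux_Cbound (C : ℕ → ℕ → ℂ)
    (hC1 : ∀ ℓ : ℕ, 1 ≤ ℓ → C 1 ℓ = (-1 : ℂ) ^ (ℓ - 1) * (Nat.factorial (ℓ - 1)))
    (hCrec : ∀ μ ℓ : ℕ, 1 ≤ μ → μ + 1 ≤ ℓ →
      C (μ + 1) ℓ = (-1 : ℂ) ^ (ℓ - 1) * (Nat.factorial (ℓ - 1)) *
        ∑ m ∈ Finset.Icc μ (ℓ - 1), (-1 : ℂ) ^ m * C μ m / (Nat.factorial m))
    (X : ℝ) (hX : 0 ≤ X) (ℓ : ℕ) (hℓ : 1 ≤ ℓ) : ∀ μ, 1 ≤ μ → μ ≤ ℓ →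
    ‖C μ ℓ‖ * X ^ μ ≤ ∏ i ∈ Finset.range ℓ, (X + i) := by
  induction ℓ, hℓ using Nat.le_induction with
  | base =>
    intro μ h1 h2
    obtain rfl : μ = 1 := by omega
    rw [hC1 1 le_rfl]; simp
  | succ ℓ hℓ ih =>
    intro μ h1 h2
    have hP : 0 ≤ ∏ i ∈ Finset.range ℓ, (X + i) := Finset.prod_nonneg fun i _ => by positivity
    rw [Finset.prod_range_succ]
    set P := ∏ i ∈ Finset.range ℓ, (X + (i:ℝ))
    have hl0 : (0:ℝ) ≤ ℓ := by positivity
    have hPX : 0 ≤ P * X := by positivity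
    have hPl : 0 ≤ P * ℓ := by positivity
    rcases eq_or_lt_of_le h1 with rfl | h1'
    · have h3 : C 1 (ℓ+1) = -ℓ * C 1 ℓ := by
        obtain ⟨k, rfl⟩ : ∃ k, ℓ = k + 1 := ⟨ℓ-1, by omega⟩
        rw [hC1 _ (by omega), hC1 _ (by omega)]
        simp only [Nat.add_sub_cancel, Nat.factorial_succ]
        push_cast
        ring
      rw [h3, norm_mul, norm_neg, Complex.norm_natCast]
      have := mul_le_mul_of_nonneg_left (ih 1 le_rfl hℓ) hl0
      nlinarith
    · obtain ⟨k, rfl⟩ : ∃ k, μ = k + 1 := ⟨μ-1, by omega⟩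
      have hk := ih k (by omega) (by omega)
      have hk' := mul_le_mul_of_nonneg_left hk hX
      rcases eq_or_lt_of_le h2 with h2' | h2'
      · have : C (k+1) (ℓ+1) = C k ℓ := by
          obtain rfl : k = ℓ := by omega
          rw [aux_Cdiag C hC1 hCrec _ (by omega), aux_Cdiag C hC1 hCrec _ (by omega)]
        rw [this, pow_succ]
        nlinarith
      · have h3 : C (k+1) (ℓ+1) = -ℓ * C (k+1) ℓ + C k ℓ := by
          rw [hCrec k (ℓ+1) (by omega) (by omega), hCrec k ℓ (by omega) (by omega)]
          obtain ⟨j, rfl⟩ : ∃ j, ℓ = j + 1 := ⟨ℓ-1, by omega⟩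
          simp only [Nat.add_sub_cancel]
          rw [Finset.sum_Icc_succ_top (by omega), mul_add]
          congr 1
          · rw [Nat.factorial_succ]; push_cast; ring
          · have : ((j+1).factorial : ℂ) ≠ 0 := by exact_mod_cast (j+1).factorial_ne_zero
            have hs : ((-1:ℂ)^(j+1)) * (-1)^(j+1) = 1 := by rw [← mul_pow]; simp
            field_simp
            linear_combination (C k (j+1)) * hs
        have hk2 := mul_le_mul_of_nonneg_left (ih (k+1) (by omega) (by omega)) hl0
        have h4 : ‖C (k+1) (ℓ+1)‖ ≤ ℓ * ‖C (k+1) ℓ‖ + ‖C k ℓ‖ := by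
          rw [h3]
          refine (norm_add_le _ _).trans (le_of_eq ?_)
          rw [norm_mul, norm_neg, Complex.norm_natCast]
        calc _ ≤ (ℓ * ‖C (k+1) ℓ‖ + ‖C k ℓ‖) * X^(k+1) := by gcongr
          _ = ℓ * (‖C (k+1) ℓ‖ * X^(k+1)) + X * (‖C k ℓ‖ * X^k) := by ring
          _ ≤ _ := by linarith

theorem aux_binom (μ k : ℕ) (hμ : 1 ≤ μ) :
    ‖(∏ i ∈ Finset.range k, (-(μ : ℂ) - i)) / (Nat.factorial k : ℂ)‖ ≤ 2 ^ (μ + k) := by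
  rw [norm_div, norm_prod, Complex.norm_natCast]
  have h1 : ∏ i ∈ Finset.range k, ‖(-(μ : ℂ) - i)‖ = (μ.ascFactorial k : ℝ) := by
    rw [Nat.ascFactorial_eq_prod_range]
    push_cast
    refine Finset.prod_congr rfl fun i _ => ?_
    rw [show (-(μ:ℂ) - i) = -((μ + i : ℕ) : ℂ) by push_cast; ring, norm_neg, Complex.norm_natCast]
    push_cast; rfl
  rw [h1, Nat.ascFactorial_eq_factorial_mul_choose', div_le_iff₀ (by positivity), mul_comm]
  push_cast
  gcongr
  have h2 : (μ + k - 1).choose k ≤ 2 ^ (μ + k) :=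
    (Nat.choose_le_two_pow _ _).trans (Nat.pow_le_pow_right (by norm_num) (by omega))
  exact_mod_cast h2

theorem aux_A (θ : ℝ) (C : ℕ → ℕ → ℂ)
    (hC1 : ∀ ℓ : ℕ, 1 ≤ ℓ → C 1 ℓ = (-1 : ℂ) ^ (ℓ - 1) * (Nat.factorial (ℓ - 1)))
    (hCrec : ∀ μ ℓ : ℕ, 1 ≤ μ → μ + 1 ≤ ℓ →
      C (μ + 1) ℓ = (-1 : ℂ) ^ (ℓ - 1) * (Nat.factorial (ℓ - 1)) *
        ∑ m ∈ Finset.Icc μ (ℓ - 1), (-1 : ℂ) ^ m * C μ m / (Nat.factorial m))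
    (A : ℕ → ℕ → ℂ → ℂ)
    (hA : ∀ (μ ν : ℕ) (s : ℂ), A μ ν s =
      ∑ k ∈ Finset.range (ν - μ + 1),
        (∏ i ∈ Finset.range k, (-(μ : ℂ) - i)) / (Nat.factorial k) * C (μ + k) ν *
          (2 * s - 1 + (θ : ℂ) * Complex.I) ^ k)
    (K : ℕ) (hK : 0 < K) (s : ℂ) (hs : ‖s‖ ≤ 2 * K) (μ ν : ℕ) (hμ : 1 ≤ μ) (hν : μ ≤ ν) :
    ‖A μ ν s‖ * (K:ℝ)^μ ≤ ν * (2 * (5 + |θ|) * (K + ν)) ^ ν := by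
  have hK1 : (1:ℝ) ≤ K := by exact_mod_cast hK
  have hE : (1:ℝ) ≤ 5 + |θ| := by have := abs_nonneg θ; linarith
  have hz : ‖2 * s - 1 + (θ : ℂ) * Complex.I‖ ≤ (5 + |θ|) * K := by
    calc _ ≤ ‖2 * s‖ + ‖(1:ℂ)‖ + ‖(θ : ℂ) * Complex.I‖ := by
            refine (norm_add_le _ _).trans ?_
            gcongr; exact norm_sub_le _ _
      _ = 2 * ‖s‖ + 1 + |θ| := by simp
      _ ≤ _ := by have := abs_nonneg θ; nlinarith
  rw [hA]
  have hterm : ∀ k ∈ Finset.range (ν - μ + 1),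
      ‖(∏ i ∈ Finset.range k, (-(μ : ℂ) - i)) / (Nat.factorial k) * C (μ + k) ν *
          (2 * s - 1 + (θ : ℂ) * Complex.I) ^ k‖ * (K:ℝ)^μ ≤ (2 * (5 + |θ|) * (K + ν)) ^ ν := by
    intro k hk
    have hk' : μ + k ≤ ν := by have := Finset.mem_range.mp hk; omega
    rw [norm_mul, norm_mul, norm_pow]
    have hb := aux_binom μ k hμ
    have hc := aux_Cbound C hC1 hCrec K (by positivity) ν (by omega) (μ+k) (by omega) hk'
    have hc' : ∏ i ∈ Finset.range ν, ((K:ℝ) + i) ≤ (K + ν)^ν := by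
      calc _ ≤ ∏ i ∈ Finset.range ν, ((K:ℝ) + ν) := by
            refine Finset.prod_le_prod (fun _ _ => by positivity) fun i hi => ?_
            have : (i:ℝ) ≤ ν := by exact_mod_cast (Finset.mem_range.mp hi).le
            linarith
        _ = _ := by simp
    set b := ‖(∏ i ∈ Finset.range k, (-(μ : ℂ) - i)) / (Nat.factorial k : ℂ)‖
    calc _ ≤ 2^(μ+k) * ‖C (μ+k) ν‖ * ((5 + |θ|) * K)^k * (K:ℝ)^μ := by gcongr
      _ = 2^(μ+k) * (5 + |θ|)^k * (‖C (μ+k) ν‖ * (K:ℝ)^(μ+k)) := by rw [mul_pow, pow_add (K:ℝ)]; ring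
      _ ≤ 2^ν * (5 + |θ|)^ν * (K + ν)^ν := by
        gcongr
        · norm_num
        · omega
        · exact hc.trans hc'
      _ = _ := by rw [mul_pow, mul_pow]
  calc _ ≤ (∑ k ∈ Finset.range (ν - μ + 1), ‖(∏ i ∈ Finset.range k, (-(μ : ℂ) - i)) / (Nat.factorial k) * C (μ + k) ν *
          (2 * s - 1 + (θ : ℂ) * Complex.I) ^ k‖) * (K:ℝ)^μ := by gcongr; exact norm_sum_le _ _
    _ ≤ ∑ k ∈ Finset.range (ν - μ + 1), (2 * (5 + |θ|) * (K + ν)) ^ ν := by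
      rw [Finset.sum_mul]; exact Finset.sum_le_sum hterm
    _ ≤ _ := by
      rw [Finset.sum_const, Finset.card_range, nsmul_eq_mul]
      gcongr
      omega
open Polynomial in
theorem aux_lin (a b : ℂ) (m : ℕ) : ((C a * X + C b) ^ m).natDegree ≤ m ∧
    ((C a * X + C b) ^ m).coeff m = a ^ m := by
  have h1 : (C a * X + C b).natDegree ≤ 1 := natDegree_linear_le
  constructor
  · exact (natDegree_pow_le_of_le m h1).trans (by simp)
  · have := coeff_pow_of_natDegree_le (m := m) h1
    simpa using this

open Polynomial in
theorem aux_bp (n : ℕ) (a b : ℂ) : ∃ q : ℂ[X], q.natDegree ≤ n ∧ q.coeff n = a ^ n ∧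
    ∀ s : ℂ, aeval (a * s + b) (Polynomial.bernoulli n) = q.eval s := by
  refine ⟨∑ i ∈ Finset.range (n+1), C ((_root_.bernoulli i * (n.choose i : ℚ) : ℚ) : ℂ) * (C a * X + C b)^(n-i), ?_, ?_, ?_⟩
  · refine natDegree_sum_le_of_forall_le _ _ fun i _ => ?_
    exact (natDegree_C_mul_le _ _).trans ((aux_lin a b (n-i)).1.trans (by omega))
  · rw [finsetSum_coeff, Finset.sum_eq_single 0]
    · rw [coeff_C_mul, Nat.sub_zero, (aux_lin a b n).2]; simp
    · intro i hi hi0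
      rw [coeff_C_mul, coeff_eq_zero_of_natDegree_lt, mul_zero]
      have := (aux_lin a b (n-i)).1
      have := Finset.mem_range.mp hi
      omega
    · simp
  · intro s
    rw [Polynomial.bernoulli, map_sum, eval_finsetSum]
    refine Finset.sum_congr rfl fun i _ => ?_
    rw [aeval_monomial]
    simp

open Polynomial in
theorem aux_PR
    (r : ℕ) (lam : Fin r → ℝ) (hlam : ∀ j, 0 < lam j)
    (hsum : ∑ j, lam j = 1)
    (mu : Fin r → ℂ) (θ : ℝ) 
    (R : ℕ → ℂ → ℂ)
    (hR : ∀ (ν : ℕ) (s : ℂ), R ν s =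
      Polynomial.aeval (1 - 2 * s - (θ : ℂ) * Complex.I) (Polynomial.bernoulli (ν + 1)) +
        Polynomial.aeval (1 : ℂ) (Polynomial.bernoulli (ν + 1)) -
        ∑ j, (Polynomial.aeval ((lam j : ℂ) * (1 - s) + (starRingEnd ℂ) (mu j))
              (Polynomial.bernoulli (ν + 1)) +
            Polynomial.aeval (1 - (lam j : ℂ) * s - mu j) (Polynomial.bernoulli (ν + 1))) /
          (lam j : ℂ) ^ ν) (ν : ℕ) :
    ∃ p : ℂ[X], p.natDegree ≤ ν + 1 ∧ p.coeff (ν+1) = (-2)^(ν+1) + 2 * (-1)^ν ∧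
      ∀ s, R ν s = p.eval s := by
  obtain ⟨q0, d0, c0, e0⟩ := aux_bp (ν+1) (-2) (1 - θ * Complex.I)
  choose q1 d1 c1 e1 using fun j => aux_bp (ν+1) (-(lam j : ℂ)) (lam j + (starRingEnd ℂ) (mu j))
  choose q2 d2 c2 e2 using fun j => aux_bp (ν+1) (-(lam j : ℂ)) (1 - mu j)
  refine ⟨q0 + C (aeval (1 : ℂ) (Polynomial.bernoulli (ν + 1))) -
    ∑ j, C (((lam j : ℂ) ^ ν)⁻¹) * (q1 j + q2 j), ?_, ?_, ?_⟩
  · refine (natDegree_sub_le _ _).trans (max_le (natDegree_add_le_of_degree_le d0 ?_) ?_)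
    · rw [natDegree_C]; exact Nat.zero_le _
    refine natDegree_sum_le_of_forall_le _ _ fun j _ => ?_
    exact (natDegree_C_mul_le _ _).trans (natDegree_add_le_of_degree_le (d1 j) (d2 j))
  · rw [coeff_sub, coeff_add, coeff_C_of_ne_zero (by omega), finsetSum_coeff, c0]
    have : ∀ j ∈ Finset.univ, (C (((lam j : ℂ) ^ ν)⁻¹) * (q1 j + q2 j)).coeff (ν+1) =
        -2 * (-1)^ν * (lam j : ℂ) := by
      intro j _
      rw [coeff_C_mul, coeff_add, c1, c2]
      have : (lam j : ℂ) ≠ 0 := by exact_mod_cast (hlam j).ne'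
      rw [show (-(lam j:ℂ))^(ν+1) = -(-1)^ν * lam j * (lam j)^ν by rw [neg_pow]; ring]
      field_simp
      ring
    rw [Finset.sum_congr rfl this, ← Finset.mul_sum]
    have : ∑ j, (lam j : ℂ) = 1 := by exact_mod_cast hsum
    rw [this]; ring
  · intro s
    rw [hR, eval_sub, eval_add, eval_C, eval_finsetSum]
    congr 1
    · congr 1
      rw [← e0]; congr 2; ring
    · refine Finset.sum_congr rfl fun j _ => ?_
      rw [eval_mul, eval_C, eval_add, ← e1, ← e2, div_eq_mul_inv, mul_comm]
      congr 3 
      · congr 1; ring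
      · congr 1; ring

open Polynomial in
theorem aux_PV (R : ℕ → ℂ → ℂ) (V : ℕ → ℂ → ℂ)
    (hV : ∀ (ν : ℕ) (s : ℂ), 1 ≤ ν → V ν s =
      (-1 : ℂ) ^ ν * ∑ m ∈ Finset.Icc 1 ν, (1 / (Nat.factorial m : ℂ)) *
        ∑ t ∈ (Finset.Nat.antidiagonalTuple m ν).filter (fun t => ∀ i, 1 ≤ t i),
          ∏ i, R (t i) s / (((t i : ℕ) : ℂ) * (((t i : ℕ) : ℂ) + 1)))
    (hP : ∀ ν, ∃ p : ℂ[X], p.natDegree ≤ ν + 1 ∧ p.coeff (ν+1) = (-2)^(ν+1) + 2 * (-1)^ν ∧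
      ∀ s, R ν s = p.eval s) (ν : ℕ) (hν : 1 ≤ ν) :
    ∃ p : ℂ[X], p.natDegree ≤ 2 * ν ∧ p.coeff (2 * ν) ≠ 0 ∧ ∀ s, V ν s = p.eval s := by
  choose p hd hc he using hP
  let T : ∀ m : ℕ, (Fin m → ℕ) → ℂ[X] := fun m t =>
    ∏ i, (C ((((t i : ℕ) : ℂ) * (((t i : ℕ) : ℂ) + 1))⁻¹) * p (t i))
  have hT : ∀ m, ∀ t ∈ (Finset.Nat.antidiagonalTuple m ν).filter (fun t => ∀ i, 1 ≤ t i),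
      (T m t).natDegree ≤ ν + m := by
    intro m t ht
    rw [Finset.mem_filter, Finset.Nat.mem_antidiagonalTuple] at ht
    refine (natDegree_prod_le _ _).trans ?_
    calc _ ≤ ∑ i, (t i + 1) := Finset.sum_le_sum fun i _ => (natDegree_C_mul_le _ _).trans (hd _)
      _ = _ := by rw [Finset.sum_add_distrib, ht.1]; simp
  have hS : ∀ m, (∑ t ∈ (Finset.Nat.antidiagonalTuple m ν).filter (fun t => ∀ i, 1 ≤ t i), T m t).natDegree ≤ ν + m :=
    fun m => natDegree_sum_le_of_forall_le _ _ (hT m)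
  refine ⟨C ((-1)^ν) * ∑ m ∈ Finset.Icc 1 ν, C (1 / (Nat.factorial m : ℂ)) *
    ∑ t ∈ (Finset.Nat.antidiagonalTuple m ν).filter (fun t => ∀ i, 1 ≤ t i), T m t, ?_, ?_, ?_⟩
  · refine (natDegree_C_mul_le _ _).trans (natDegree_sum_le_of_forall_le _ _ fun m hm => ?_)
    have := (Finset.mem_Icc.mp hm).2
    exact (natDegree_C_mul_le _ _).trans ((hS m).trans (by omega))
  · rw [coeff_C_mul, finsetSum_coeff, Finset.sum_eq_single ν]
    · have hset : (Finset.Nat.antidiagonalTuple ν ν).filter (fun t => ∀ i, 1 ≤ t i) = {fun _ => 1} := by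
        ext t
        rw [Finset.mem_filter, Finset.Nat.mem_antidiagonalTuple, Finset.mem_singleton]
        constructor
        · rintro ⟨h1, h2⟩
          have h3 : ∑ i : Fin ν, 1 = ∑ i, t i := by rw [h1]; simp
          have h4 := (Finset.sum_eq_sum_iff_of_le (fun i _ => h2 i)).mp h3
          funext i
          exact (h4 i (Finset.mem_univ i)).symm
        · rintro rfl
          simp
      rw [hset, Finset.sum_singleton, coeff_C_mul]
      have hTc : T ν (fun _ => 1) = (C ((2:ℂ)⁻¹) * p 1)^ν := by
        simp only [T, Finset.prod_const, Finset.card_univ, Fintype.card_fin]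
        norm_num
      have h2 : (C ((2:ℂ)⁻¹) * p 1).natDegree ≤ 2 := (natDegree_C_mul_le _ _).trans (hd 1)
      rw [hTc, mul_comm 2 ν, coeff_pow_of_natDegree_le h2, coeff_C_mul, hc 1]
      have : (ν.factorial : ℂ) ≠ 0 := by exact_mod_cast ν.factorial_ne_zero
      refine mul_ne_zero (by simp) (mul_ne_zero (by simpa using this) (pow_ne_zero _ ?_))
      norm_num
    · intro m hm hne
      have := (Finset.mem_Icc.mp hm).2
      rw [coeff_eq_zero_of_natDegree_lt]
      refine ((natDegree_C_mul_le _ _).trans (hS m)).trans_lt ?_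
      omega
    · intro h; exact absurd (Finset.mem_Icc.mpr ⟨hν, le_rfl⟩) h
  · intro s
    rw [hV ν s hν, eval_mul, eval_C, eval_finsetSum]
    congr 1
    refine Finset.sum_congr rfl fun m _ => ?_
    rw [eval_mul, eval_C, eval_finsetSum]
    congr 1
    refine Finset.sum_congr rfl fun t _ => ?_
    rw [eval_prod]
    refine Finset.prod_congr rfl fun i _ => ?_
    rw [eval_mul, eval_C, ← he, div_eq_mul_inv, mul_comm]

open Polynomial in
theorem aux_PQ (θ : ℝ) (V : ℕ → ℂ → ℂ)
    (hP : ∀ ν, 1 ≤ ν → 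
      ∃ p : ℂ[X], p.natDegree ≤ 2 * ν ∧ p.coeff (2 * ν) ≠ 0 ∧ ∀ s, V ν s = p.eval s)
    (C : ℕ → ℕ → ℂ)
    (hCd : ∀ μ, 1 ≤ μ → C μ μ = 1)
    (A : ℕ → ℕ → ℂ → ℂ)
    (hA : ∀ (μ ν : ℕ) (s : ℂ), A μ ν s =
      ∑ k ∈ Finset.range (ν - μ + 1),
        (∏ i ∈ Finset.range k, (-(μ : ℂ) - i)) / (Nat.factorial k) * C (μ + k) ν *
          (2 * s - 1 + (θ : ℂ) * Complex.I) ^ k)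
    (Q : ℕ → ℂ → ℂ)
    (hQ : ∀ (ν : ℕ) (s : ℂ), Q ν s = ∑ μ ∈ Finset.Icc 1 ν, V μ s * A μ ν s) (ν : ℕ) (hν : 1 ≤ ν) :
    ∃ P : Polynomial ℂ, P.degree = (2 * ν : ℕ) ∧ ∀ s : ℂ, Q ν s = P.eval s := by
  choose! p hd hc he using hP
  have hPA : ∀ μ, ∃ q : ℂ[X], q.natDegree ≤ ν - μ ∧ ∀ s, A μ ν s = q.eval s := by
    intro μ
    refine ⟨∑ k ∈ Finset.range (ν - μ + 1), Polynomial.C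
      ((∏ i ∈ Finset.range k, (-(μ : ℂ) - i)) / (Nat.factorial k) * C (μ + k) ν) *
        (Polynomial.C 2 * X + Polynomial.C (-1 + (θ : ℂ) * Complex.I))^k, ?_, ?_⟩
    · refine natDegree_sum_le_of_forall_le _ _ fun k hk => ?_
      have := Finset.mem_range.mp hk
      exact (natDegree_C_mul_le _ _).trans ((aux_lin _ _ k).1.trans (by omega))
    · intro s
      rw [hA, eval_finsetSum]
      refine Finset.sum_congr rfl fun k _ => ?_
      rw [eval_mul, eval_C, eval_pow]
      congr 2
      simp only [eval_add, eval_mul, eval_C, eval_X]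
      ring
  choose q qd qe using hPA
  have hA1 : ∀ s, A ν ν s = 1 := by
    intro s
    rw [hA]; simp [hCd ν hν]
  have hle : ∀ μ ∈ Finset.Ico 1 ν, (p μ * q μ).natDegree ≤ 2 * ν - 1 := by
    intro μ hμ
    have h := Finset.mem_Ico.mp hμ
    have h1 := hd μ h.1
    have h2 := qd μ
    refine natDegree_mul_le.trans ?_
    omega
  have hsm := natDegree_sum_le_of_forall_le (Finset.Ico 1 ν) (fun μ => p μ * q μ) hle
  have hco : (p ν + ∑ μ ∈ Finset.Ico 1 ν, p μ * q μ).coeff (2 * ν) ≠ 0 := by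
    rw [coeff_add, coeff_eq_zero_of_natDegree_lt (hsm.trans_lt (by omega)), add_zero]
    exact hc ν hν
  refine ⟨p ν + ∑ μ ∈ Finset.Ico 1 ν, p μ * q μ, ?_, ?_⟩
  · refine degree_eq_of_le_of_coeff_ne_zero ?_ hco
    refine natDegree_le_iff_degree_le.mp ?_
    exact natDegree_add_le_of_degree_le (hd ν hν) (hsm.trans (by omega))
  · intro s
    rw [hQ, ← Finset.Ico_succ_right_eq_Icc, Order.succ_eq_add_one, Finset.sum_Ico_succ_top hν, hA1,
      mul_one, eval_add, ← he ν hν, add_comm, eval_finsetSum]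
    congr 1
    refine Finset.sum_congr rfl fun μ hμ => ?_
    rw [eval_mul, ← he μ (Finset.mem_Ico.mp hμ).1, ← qe]

theorem aux_pow (x G : ℝ) (hx : 1 ≤ x) (hG : x ≤ G) (ν K n : ℕ) (hK : 0 < K) (hν : ν ≤ K + n) :
    x ^ ν ≤ (G ^ (1 + n)) ^ K := by
  rw [← pow_mul]
  calc x ^ ν ≤ x ^ ((1+n) * K) := pow_le_pow_right₀ hx (by nlinarith)
    _ ≤ _ := by gcongr

/-- Lemma 3.19: uniform bounds on disks `|s| ≤ 2K` for the polynomials `R_ν`, `V_ν` and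
`Q_ν` of the transformation formula, together with `deg Q_ν = 2ν` (using degree 2, i.e.
`Σ λ_j = 1`). -/
theorem stmt_19
    (r : ℕ) (hr : 1 ≤ r) (lam : Fin r → ℝ) (hlam : ∀ j, 0 < lam j)
    (hsum : ∑ j, lam j = 1)
    (mu : Fin r → ℂ) (θ : ℝ) (hθ : θ = (2 * ∑ j, (mu j - 1 / 2)).im)
    (R : ℕ → ℂ → ℂ)
    (hR : ∀ (ν : ℕ) (s : ℂ), R ν s =
      Polynomial.aeval (1 - 2 * s - (θ : ℂ) * Complex.I) (Polynomial.bernoulli (ν + 1)) +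
        Polynomial.aeval (1 : ℂ) (Polynomial.bernoulli (ν + 1)) -
        ∑ j, (Polynomial.aeval ((lam j : ℂ) * (1 - s) + (starRingEnd ℂ) (mu j))
              (Polynomial.bernoulli (ν + 1)) +
            Polynomial.aeval (1 - (lam j : ℂ) * s - mu j) (Polynomial.bernoulli (ν + 1))) /
          (lam j : ℂ) ^ ν)
    (V : ℕ → ℂ → ℂ)
    (hV : ∀ (ν : ℕ) (s : ℂ), 1 ≤ ν → V ν s =
      (-1 : ℂ) ^ ν * ∑ m ∈ Finset.Icc 1 ν, (1 / (Nat.factorial m : ℂ)) *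
        ∑ t ∈ (Finset.Nat.antidiagonalTuple m ν).filter (fun t => ∀ i, 1 ≤ t i),
          ∏ i, R (t i) s / (((t i : ℕ) : ℂ) * (((t i : ℕ) : ℂ) + 1)))
    (C : ℕ → ℕ → ℂ)
    (hC1 : ∀ ℓ : ℕ, 1 ≤ ℓ → C 1 ℓ = (-1 : ℂ) ^ (ℓ - 1) * (Nat.factorial (ℓ - 1)))
    (hCrec : ∀ μ ℓ : ℕ, 1 ≤ μ → μ + 1 ≤ ℓ →
      C (μ + 1) ℓ = (-1 : ℂ) ^ (ℓ - 1) * (Nat.factorial (ℓ - 1)) *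
        ∑ m ∈ Finset.Icc μ (ℓ - 1), (-1 : ℂ) ^ m * C μ m / (Nat.factorial m))
    (A : ℕ → ℕ → ℂ → ℂ)
    (hA : ∀ (μ ν : ℕ) (s : ℂ), A μ ν s =
      ∑ k ∈ Finset.range (ν - μ + 1),
        (∏ i ∈ Finset.range k, (-(μ : ℂ) - i)) / (Nat.factorial k) * C (μ + k) ν *
          (2 * s - 1 + (θ : ℂ) * Complex.I) ^ k)
    (Q : ℕ → ℂ → ℂ)
    (hQ : ∀ (ν : ℕ) (s : ℂ), Q ν s = ∑ μ ∈ Finset.Icc 1 ν, V μ s * A μ ν s) :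
    (∀ c : ℝ, 1 ≤ c → ∃ A₀ : ℝ, 0 < A₀ ∧
      ∀ K : ℕ, 0 < K → ∀ s : ℂ, ‖s‖ ≤ 2 * K →
        ∀ ν : ℕ, 1 ≤ ν → (ν : ℝ) ≤ K + c →
          ‖R ν s‖ ≤ A₀ ^ K * (K : ℝ) ^ ν ∧
          ‖V ν s‖ ≤ A₀ ^ K * (K : ℝ) ^ ν ∧
          ‖Q ν s‖ ≤ (A₀ * K) ^ K) ∧
    (∀ ν : ℕ, 1 ≤ ν → ∃ P : Polynomial ℂ,
      P.degree = (2 * ν : ℕ) ∧ ∀ s : ℂ, Q ν s = P.eval s) := by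
  refine ⟨?_, ?_⟩
  swap
  · exact aux_PQ θ V (aux_PV R V hV (aux_PR r lam hlam hsum mu θ R hR)) C
      (aux_Cdiag C hC1 hCrec) A hA Q hQ
  intro c hc
  obtain ⟨n, hn⟩ : ∃ n, n = ⌈c⌉₊ := ⟨_, rfl⟩
  obtain ⟨B, hB, hRb⟩ := aux_R r lam hlam hsum mu θ R hR n
  obtain ⟨E, hE⟩ : ∃ E, E = 5 + |θ| := ⟨_, rfl⟩
  have hE1 : 1 ≤ E := by rw [hE]; have := abs_nonneg θ; linarith
  obtain ⟨G, hG⟩ : ∃ G, G = 16 * B * E * (n + 2 : ℝ) := ⟨_, rfl⟩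
  have hn0 : (0:ℝ) ≤ n := by positivity
  have hBE : B ≤ B * E := le_mul_of_one_le_right (by linarith) hE1
  have hGB : 2 * B ≤ G := by
    rw [hG]
    have : 1 * 1 ≤ B * E := by gcongr
    nlinarith
  have hG1 : 1 ≤ G := by linarith
  have hGL : 1 ≤ G ^ (1 + n) := one_le_pow₀ hG1
  have he1 : 1 ≤ Real.exp 1 := Real.one_le_exp (by norm_num)
  have h2n : (1:ℝ) ≤ 2 ^ n := one_le_pow₀ (by norm_num)
  refine ⟨Real.exp 1 * 2 * 2 ^ n * G ^ (1 + n), by positivity, ?_⟩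
  intro K hK s hs ν hν1 hνc
  have hK1 : (1:ℝ) ≤ K := by exact_mod_cast hK
  have hνn : ν ≤ K + n := by
    have : (ν:ℝ) ≤ ((K + n : ℕ) : ℝ) := by
      push_cast; rw [hn]; have := Nat.le_ceil c; linarith
    exact_mod_cast this
  have hexp : Real.exp K = Real.exp 1 ^ K := by rw [← Real.exp_nat_mul, mul_one]
  have hK2 : (K:ℝ) ≤ 2 ^ K := by exact_mod_cast (Nat.lt_two_pow_self (n := K)).le
  have heK : 1 ≤ Real.exp 1 ^ K := one_le_pow₀ he1
  have h2K : (1:ℝ) ≤ 2 ^ K := one_le_pow₀ (by norm_num)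
  have h2nK : (1:ℝ) ≤ (2 ^ n) ^ K := one_le_pow₀ h2n
  have hGLK : 1 ≤ (G ^ (1 + n)) ^ K := one_le_pow₀ hGL
  have hVb : ∀ μ, 1 ≤ μ → μ ≤ ν → ‖V μ s‖ ≤ Real.exp K * (2 * B * K) ^ μ := fun μ h1 h2 =>
    aux_V R V hV B hB K s μ h1 (fun m h3 h4 => hRb K hK s hs m h3 (by omega))
  refine ⟨?_, ?_, ?_⟩
  · calc _ ≤ B ^ ν * (K:ℝ) ^ (ν + 1) := hRb K hK s hs ν hν1 hνn
      _ = 1 * K * 1 * B ^ ν * (K:ℝ) ^ ν := by ring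
      _ ≤ Real.exp 1 ^ K * 2 ^ K * (2 ^ n) ^ K * (G ^ (1 + n)) ^ K * (K:ℝ) ^ ν := by
        gcongr
        exact aux_pow B G hB (by linarith) ν K n hK hνn
      _ = _ := by simp only [mul_pow]
  · calc _ ≤ Real.exp K * (2 * B * K) ^ ν := hVb ν hν1 le_rfl
      _ = Real.exp 1 ^ K * 1 * 1 * (2 * B) ^ ν * (K:ℝ) ^ ν := by rw [hexp, mul_pow _ (K:ℝ)]; ring
      _ ≤ Real.exp 1 ^ K * 2 ^ K * (2 ^ n) ^ K * (G ^ (1 + n)) ^ K * (K:ℝ) ^ ν := by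
        gcongr
        exact aux_pow (2 * B) G (by linarith) hGB ν K n hK hνn
      _ = _ := by simp only [mul_pow]
  · rw [hQ]
    have hν2 : (ν:ℝ) ≤ 2 ^ ν := by exact_mod_cast (Nat.lt_two_pow_self (n := ν)).le
    have hνK : (K:ℝ) + ν ≤ (n + 2) * K := by
      have : (ν:ℝ) ≤ K + n := by exact_mod_cast hνn
      nlinarith
    have hterm : ∀ μ ∈ Finset.Icc 1 ν, ‖V μ s * A μ ν s‖ ≤
        Real.exp K * (2 * B) ^ ν * (2 ^ ν * (2 * E * ((n + 2) * K)) ^ ν) := by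
      intro μ hμ
      have h := Finset.mem_Icc.mp hμ
      rw [norm_mul]
      have hAb := aux_A θ C hC1 hCrec A hA K hK s hs μ ν h.1 h.2
      rw [← hE] at hAb
      calc _ ≤ Real.exp K * (2 * B * K) ^ μ * ‖A μ ν s‖ := by gcongr; exact hVb μ h.1 h.2
        _ = Real.exp K * (2 * B) ^ μ * (‖A μ ν s‖ * (K:ℝ) ^ μ) := by rw [mul_pow _ (K:ℝ)]; ring
        _ ≤ Real.exp K * (2 * B) ^ ν * (ν * (2 * E * (K + ν)) ^ ν) := by
          gcongr
          · linarith
          · exact h.2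
        _ ≤ _ := by gcongr
    refine (norm_sum_le _ _).trans ((Finset.sum_le_sum hterm).trans ?_)
    rw [Finset.sum_const, Nat.card_Icc, Nat.add_sub_cancel, nsmul_eq_mul]
    calc _ ≤ 2 ^ ν * (Real.exp K * (2 * B) ^ ν * (2 ^ ν * (2 * E * ((n + 2) * K)) ^ ν)) := by gcongr
      _ = Real.exp 1 ^ K * 1 * G ^ ν * (K:ℝ) ^ ν := by
        rw [hexp, hG, show (16:ℝ) * B * E * (n + 2) = 2 * (2 * B) * 2 * (2 * E * (n + 2)) by ring]
        simp only [mul_pow]; ring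
      _ ≤ Real.exp 1 ^ K * 2 ^ K * (G ^ (1 + n)) ^ K * ((2 ^ n) ^ K * (K:ℝ) ^ K) := by
        gcongr
        · exact aux_pow G G hG1 le_rfl ν K n hK hνn
        · calc (K:ℝ) ^ ν ≤ (K:ℝ) ^ (K + n) := pow_le_pow_right₀ hK1 hνn
            _ = (K:ℝ) ^ n * (K:ℝ) ^ K := by rw [pow_add, mul_comm]
            _ ≤ (2 ^ K) ^ n * (K:ℝ) ^ K := by gcongr
            _ = _ := by rw [← pow_mul, ← pow_mul, mul_comm K n]
      _ = _ := by simp only [mul_pow]; ring
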